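/- arXiv:2202.02289 — 5 statements merged into one kernel-verified Lean document; each statement's English description precedes it below -/
import Mathlib

section
/- It holds that p_k = C₁ k^{−α−2} for all k ≥ 2 for some finite positive constant C₁ if and only if there exists L > 0 such that 𝔞_k = C₀ L^{−k} k^{−α−2} for all k ≥ 2, where C₀ = (Σ_{k=2}^∞ (k−1)(k−2)/(2 k^{α+2}))^{−1}. Moreover, in that case C₁ = C₀ (1 + C₀ Σ_{k=2}^∞ (k−1) k^{−α−2})^{−1}. -/
open scoped ENNReal NNReal Topology
open Filter

/-- A positive `x` is determined by the value of a convergent power series with nonnegative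
coefficients that are not all zero. -/
lemma eq_one_of_tsum_mul_pow_eq {w : ℕ → ℝ} (hw : ∀ k, 0 ≤ w k) {j : ℕ} (hj : 0 < w j) {x : ℝ}
    (hx : 0 < x) (hsw : Summable w) (hswx : Summable fun k => w k * x ^ (k + 2))
    (h : ∑' k, w k * x ^ (k + 2) = ∑' k, w k) : x = 1 := by
  rcases lt_trichotomy x 1 with hlt | heq | hgt
  · refine absurd h (ne_of_lt (Summable.tsum_lt_tsum (i := j) (fun k => ?_) ?_ hswx hsw))
    · exact mul_le_of_le_one_right (hw k) (pow_le_one₀ hx.le hlt.le)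
    · exact mul_lt_of_lt_one_right hj (pow_lt_one₀ hx.le hlt (by omega))
  · exact heq
  · refine absurd h (ne_of_gt (Summable.tsum_lt_tsum (i := j) (fun k => ?_) ?_ hsw hswx))
    · exact le_mul_of_one_le_right (hw k) (one_le_pow₀ hgt.le)
    · exact lt_mul_of_one_lt_right hj (one_lt_pow₀ hgt (by omega))

/-- With `α ∈ (1,2)`, weights `(a k)_{k ≥ 2}` (with `a 0 = 1`), `λ ∈ (0, ∞)`
satisfying `Σ_{k≥2} ((k-1)(k-2)/2) a_k λ^k = 1`, `C = λ⁻² + Σ_{k≥2} (k-1) a_k λ^{k-2}` and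
`p_k = a_k λ^{k-2} / C`:  one has `p k = C₁ k^{-α-2}` for all `k ≥ 2` for some finite positive
constant `C₁` iff there is `L > 0` with `a k = C₀ L^{-k} k^{-α-2}` for all `k ≥ 2`, where
`C₀ = (Σ_{k≥2} (k-1)(k-2)/(2 k^{α+2}))⁻¹`; moreover in that case
`C₁ = C₀ (1 + C₀ Σ_{k≥2} (k-1) k^{-α-2})⁻¹`. -/
theorem stmt1 (α : ℝ) (hα1 : 1 < α) (hα2 : α < 2)
    (a : ℕ → ℝ) (ha0 : a 0 = 1) (ha : ∀ k, 0 ≤ a k) (hpos : ∃ k, 3 ≤ k ∧ 0 < a k)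
    (lam : ℝ) (hlam : 0 < lam)
    (hsum : ∑' k : ℕ,
      (((k : ℝ) + 2) - 1) * (((k : ℝ) + 2) - 2) / 2 * a (k + 2) * lam ^ (k + 2) = 1)
    (C : ℝ) (hC : C = lam⁻¹ ^ 2 + ∑' k : ℕ, (((k : ℝ) + 2) - 1) * a (k + 2) * lam ^ k)
    (p : ℕ → ℝ) (hp : ∀ k : ℕ, p k = a k * lam ^ ((k : ℤ) - 2) / C)
    (C₀ : ℝ)
    (hC₀ : C₀ = (∑' k : ℕ,
      (((k : ℝ) + 2) - 1) * (((k : ℝ) + 2) - 2) / (2 * ((k : ℝ) + 2) ^ (α + 2)))⁻¹) :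
    ((∃ C₁ : ℝ, 0 < C₁ ∧ ∀ k : ℕ, 2 ≤ k → p k = C₁ * (k : ℝ) ^ (-α - 2)) ↔
      (∃ L : ℝ, 0 < L ∧ ∀ k : ℕ, 2 ≤ k → a k = C₀ * L ^ (-(k : ℤ)) * (k : ℝ) ^ (-α - 2))) ∧
    (∀ C₁ : ℝ, 0 < C₁ → (∀ k : ℕ, 2 ≤ k → p k = C₁ * (k : ℝ) ^ (-α - 2)) →
      C₁ = C₀ * (1 + C₀ * ∑' k : ℕ, (((k : ℝ) + 2) - 1) * ((k : ℝ) + 2) ^ (-α - 2))⁻¹) := by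
  set w : ℕ → ℝ := fun k =>
    (((k : ℝ) + 2) - 1) * (((k : ℝ) + 2) - 2) / (2 * ((k : ℝ) + 2) ^ (α + 2)) with hw
  set V : ℝ := ∑' k : ℕ, (((k : ℝ) + 2) - 1) * ((k : ℝ) + 2) ^ (-α - 2) with hV
  have hw0 : ∀ k, 0 ≤ w k := fun k => by
    have h1 : (0 : ℝ) ≤ (k : ℝ) + 2 - 1 := by linarith [Nat.cast_nonneg (α := ℝ) k]
    have h2 : (0 : ℝ) ≤ (k : ℝ) + 2 - 2 := by linarith [Nat.cast_nonneg (α := ℝ) k]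
    simp only [hw]
    positivity
  have hw1 : 0 < w 1 := by
    simp only [hw]
    norm_num
    positivity
  have hV0 : 0 ≤ V := tsum_nonneg fun k => by
    have h1 : (0 : ℝ) ≤ (k : ℝ) + 2 - 1 := by linarith [Nat.cast_nonneg (α := ℝ) k]
    positivity
  have hCpos : 0 < C := by
    rw [hC]
    refine add_pos_of_pos_of_nonneg (by positivity) (tsum_nonneg fun k => ?_)
    have h1 : (0 : ℝ) ≤ (k : ℝ) + 2 - 1 := by linarith [Nat.cast_nonneg (α := ℝ) k]
    have h2 := ha (k + 2)
    positivity
  have hnormalize : ∀ K L : ℝ, 0 < L →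
      (∀ k : ℕ, 2 ≤ k → a k = K * L ^ (-(k : ℤ)) * (k : ℝ) ^ (-α - 2)) →
      K * ∑' k, w k * (lam / L) ^ (k + 2) = 1 := by
    intro K L hL h
    rw [← hsum, ← tsum_mul_left]
    refine tsum_congr fun k => ?_
    have hk : (0 : ℝ) < (k : ℝ) + 2 := by positivity
    rw [h (k + 2) (by omega), zpow_neg, zpow_natCast, show -α - 2 = -(α + 2) by ring]
    push_cast
    rw [Real.rpow_neg hk.le, div_pow]
    have := Real.rpow_pos_of_pos hk (α + 2)
    simp only [hw]
    field_simp
  have ha_of_p : ∀ C₁ : ℝ, (∀ k : ℕ, 2 ≤ k → p k = C₁ * (k : ℝ) ^ (-α - 2)) →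
      ∀ k : ℕ, 2 ≤ k → a k = (C₁ * C * lam ^ 2) * lam ^ (-(k : ℤ)) * (k : ℝ) ^ (-α - 2) := by
    intro C₁ h k hk
    have h1 := h k hk
    rw [hp, zpow_sub₀ hlam.ne', zpow_natCast, div_eq_iff hCpos.ne'] at h1
    rw [zpow_neg, zpow_natCast]
    norm_cast at h1 ⊢
    field_simp at h1 ⊢
    linarith
  have hconst : ∀ C₁ : ℝ, (∀ k : ℕ, 2 ≤ k → p k = C₁ * (k : ℝ) ^ (-α - 2)) →
      C₁ * C * lam ^ 2 = C₀ := by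
    intro C₁ h
    have h1 := hnormalize _ lam hlam (ha_of_p C₁ h)
    simp only [div_self hlam.ne', one_pow, mul_one] at h1
    rw [hC₀]
    exact eq_inv_of_mul_eq_one_left h1
  refine ⟨⟨?_, ?_⟩, ?_⟩
  · rintro ⟨C₁, -, h⟩
    exact ⟨lam, hlam, hconst C₁ h ▸ ha_of_p C₁ h⟩
  · rintro ⟨L, hL, h⟩
    have h1 := hnormalize C₀ L hL h
    have hC₀ne : C₀ ≠ 0 := left_ne_zero_of_mul_eq_one h1
    have hWne : ∑' k, w k ≠ 0 := fun h0 => hC₀ne (by rw [hC₀, h0, inv_zero])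
    have hC₀pos : 0 < C₀ :=
      lt_of_le_of_ne (by rw [hC₀]; exact inv_nonneg.2 (tsum_nonneg hw0)) hC₀ne.symm
    have hsw : Summable w := by
      by_contra h0
      exact hWne (tsum_eq_zero_of_not_summable h0)
    have hswx : Summable fun k => w k * (lam / L) ^ (k + 2) := by
      by_contra h0
      exact right_ne_zero_of_mul_eq_one h1 (tsum_eq_zero_of_not_summable h0)
    have hratio : lam / L = 1 := by
      refine eq_one_of_tsum_mul_pow_eq hw0 hw1 (div_pos hlam hL) hsw hswx ?_
      rw [eq_inv_of_mul_eq_one_right h1, hC₀, inv_inv]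
    obtain rfl : lam = L := (div_eq_one_iff_eq hL.ne').1 hratio
    refine ⟨C₀ / (C * lam ^ 2), by positivity, fun k hk => ?_⟩
    rw [hp, h k hk, zpow_sub₀ hlam.ne', zpow_neg, zpow_natCast]
    norm_cast
    field_simp
  · intro C₁ hC₁ h
    have hK := hconst C₁ h
    have hCV : ∑' k : ℕ, (((k : ℝ) + 2) - 1) * a (k + 2) * lam ^ k = C₁ * C * V := by
      rw [hV, ← tsum_mul_left]
      refine tsum_congr fun k => ?_
      rw [ha_of_p C₁ h (k + 2) (by omega), zpow_neg, zpow_natCast]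
      push_cast
      field_simp
      ring
    rw [hCV] at hC
    have hC₀pos : 0 < C₀ := by rw [← hK]; positivity
    have hden : 0 < 1 + C₀ * V := by positivity
    have hC' : C * lam ^ 2 = 1 + C₀ * V := by
      rw [← hK]
      field_simp at hC
      linear_combination hC
    rw [← div_eq_mul_inv, eq_div_iff hden.ne', ← hC']
    linear_combination hK
end

section
/- Let (ν_n) be a sequence of Radon measures and ν a Radon measure on ℝ² ∖ {0}, and suppose that ν_n(I) → ν(I) as n → ∞ for every rectangle I (a product of two intervals, open or closed) whose closure does not contain 0. Then for every open set U ⊆ ℝ² with 0 ∉ closure(U), one has ν(U) ≤ liminf_{n→∞} ν_n(U). -/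
open MeasureTheory Filter Set
open scoped ENNReal Topology

/-- If `μₙ(A) → μ(A) < ∞` for every `A` in a class `C` of measurable sets closed under
intersections, the same holds for finite unions of members of `C`. -/
theorem tendsto_measure_biUnion_finset {α ι : Type*} [MeasurableSpace α] {μ : Measure α}
    {μn : ℕ → Measure α} {C : Set (Set α)} (hmeas : ∀ A ∈ C, MeasurableSet A)
    (hinter : ∀ A ∈ C, ∀ B ∈ C, A ∩ B ∈ C) (hfin : ∀ A ∈ C, μ A ≠ ∞)
    (hnfin : ∀ n, ∀ A ∈ C, μn n A ≠ ∞)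
    (hlim : ∀ A ∈ C, Tendsto (fun n => μn n A) atTop (𝓝 (μ A)))
    (s : Finset ι) (f : ι → Set α) (hf : ∀ i, f i ∈ C) :
    Tendsto (fun n => μn n (⋃ i ∈ s, f i)) atTop (𝓝 (μ (⋃ i ∈ s, f i))) := by
  classical
  induction s using Finset.induction_on generalizing f with
  | empty => simp
  | insert a s _ ih =>
    have union_eq : ∀ ρ : Measure α, (∀ A ∈ C, ρ A ≠ ∞) →
        ρ (⋃ i ∈ insert a s, f i) =
          ρ (f a) + ρ (⋃ i ∈ s, f i) - ρ (⋃ i ∈ s, f a ∩ f i) := by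
      intro ρ hρ
      have hB : MeasurableSet (⋃ i ∈ s, f i) :=
        s.measurableSet_biUnion fun i _ => hmeas _ (hf i)
      rw [Finset.set_biUnion_insert, ← measure_union_add_inter (f a) hB, inter_iUnion₂]
      refine (ENNReal.add_sub_cancel_right ?_).symm
      rw [← inter_iUnion₂]
      exact measure_ne_top_of_subset inter_subset_left (hρ _ (hf a))
    simp_rw [union_eq μ hfin, fun n => union_eq (μn n) (hnfin n)]
    refine ENNReal.Tendsto.sub ((hlim _ (hf a)).add (ih f hf))
      (ih (fun i => f a ∩ f i) fun i => hinter _ (hf a) _ (hf i)) (Or.inr ?_)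
    rw [← inter_iUnion₂]
    exact measure_ne_top_of_subset inter_subset_left (hfin _ (hf a))

/-- Setwise convergence on a class of measurable sets closed under intersections gives lower
semicontinuity on countable unions of members of the class. -/
theorem measure_iUnion_le_liminf {α : Type*} [MeasurableSpace α] {μ : Measure α}
    {μn : ℕ → Measure α} {C : Set (Set α)} (hmeas : ∀ A ∈ C, MeasurableSet A)
    (hinter : ∀ A ∈ C, ∀ B ∈ C, A ∩ B ∈ C) (hfin : ∀ A ∈ C, μ A ≠ ∞)
    (hnfin : ∀ n, ∀ A ∈ C, μn n A ≠ ∞)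
    (hlim : ∀ A ∈ C, Tendsto (fun n => μn n A) atTop (𝓝 (μ A)))
    (f : ℕ → Set α) (hf : ∀ i, f i ∈ C) :
    μ (⋃ i, f i) ≤ liminf (fun n => μn n (⋃ i, f i)) atTop := by
  rw [measure_iUnion_eq_iSup_accumulate]
  refine iSup_le fun k => ?_
  have hk : accumulate f k = ⋃ i ∈ Finset.range (k + 1), f i := by
    simp [accumulate_def]
  rw [hk, ← (tendsto_measure_biUnion_finset hmeas hinter hfin hnfin hlim
    (Finset.range (k + 1)) f hf).liminf_eq]
  exact liminf_le_liminf (Eventually.of_forall fun n =>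
    measure_mono (iUnion₂_subset fun i _ => subset_iUnion f i))

/-- An open subset of the plane is a countable union of bounded open rectangles. -/
theorem exists_iUnion_Ioo_prod_Ioo_eq {U : Set (ℝ × ℝ)} (hU : IsOpen U) :
    ∃ f : ℕ → Set (ℝ × ℝ), (∀ i, ∃ a b c d : ℝ, f i = Ioo a b ×ˢ Ioo c d) ∧ ⋃ i, f i = U := by
  let S : Set (Set (ℝ × ℝ)) := {R | (∃ a b c d : ℝ, R = Ioo a b ×ˢ Ioo c d) ∧ R ⊆ U}
  have hempty : ∅ ∈ S := ⟨⟨0, 0, 0, 0, by simp⟩, empty_subset U⟩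
  have hSU : ⋃₀ S = U := by
    refine (sUnion_subset fun R hR => hR.2).antisymm fun x hx => ?_
    obtain ⟨ε, hε, hball⟩ := Metric.isOpen_iff.1 hU x hx
    refine ⟨Metric.ball x ε, ⟨⟨x.1 - ε, x.1 + ε, x.2 - ε, x.2 + ε, ?_⟩, hball⟩,
      Metric.mem_ball_self hε⟩
    rw [← Real.ball_eq_Ioo, ← Real.ball_eq_Ioo, ball_prod_same]
  obtain ⟨T, hTc, hTS, hTU⟩ := TopologicalSpace.isOpen_sUnion_countable S (by
    rintro R ⟨⟨a, b, c, d, rfl⟩, -⟩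
    exact isOpen_Ioo.prod isOpen_Ioo)
  obtain ⟨f, hf⟩ := (hTc.insert ∅).exists_eq_range (insert_nonempty _ _)
  refine ⟨f, fun i => ?_, ?_⟩
  · have hi : f i ∈ insert ∅ T := hf ▸ mem_range_self i
    exact (insert_subset hempty hTS hi).1
  · rw [← sUnion_range, ← hf, sUnion_insert, empty_union, hTU, hSU]

/-- Let `(νₙ)` and `ν` be Radon measures on `ℝ² ∖ {0}` (Borel measures on `ℝ²`
which are finite on every Borel set whose closure does not contain `0`), and suppose that
`νₙ(I) → ν(I)` for every rectangle `I` (a product of two intervals, open or closed) whose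
closure does not contain `0`.  Then for every open `U ⊆ ℝ²` with `0 ∉ closure U` one has
`ν(U) ≤ liminf νₙ(U)`. -/
theorem stmt4 (ν : Measure (ℝ × ℝ)) (νn : ℕ → Measure (ℝ × ℝ))
    (hνfin : ∀ B : Set (ℝ × ℝ), MeasurableSet B → (0 : ℝ × ℝ) ∉ closure B → ν B < ∞)
    (hνnfin : ∀ n, ∀ B : Set (ℝ × ℝ), MeasurableSet B → (0 : ℝ × ℝ) ∉ closure B → νn n B < ∞)
    (hrect : ∀ I₁ I₂ : Set ℝ,
      (∃ a b : ℝ, I₁ = Set.Ioo a b ∨ I₁ = Set.Icc a b) →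
      (∃ a b : ℝ, I₂ = Set.Ioo a b ∨ I₂ = Set.Icc a b) →
      (0 : ℝ × ℝ) ∉ closure (I₁ ×ˢ I₂) →
      Tendsto (fun n => νn n (I₁ ×ˢ I₂)) atTop (𝓝 (ν (I₁ ×ˢ I₂)))) :
    ∀ U : Set (ℝ × ℝ), IsOpen U → (0 : ℝ × ℝ) ∉ closure U →
      ν U ≤ liminf (fun n => νn n U) atTop := by
  intro U hU h0
  obtain ⟨f, hf, rfl⟩ := exists_iUnion_Ioo_prod_Ioo_eq hU
  let C : Set (Set (ℝ × ℝ)) :=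
    {R | (∃ a b c d : ℝ, R = Ioo a b ×ˢ Ioo c d) ∧ (0 : ℝ × ℝ) ∉ closure R}
  have hmeas : ∀ A ∈ C, MeasurableSet A := by
    rintro A ⟨⟨a, b, c, d, rfl⟩, -⟩
    exact measurableSet_Ioo.prod measurableSet_Ioo
  refine measure_iUnion_le_liminf (C := C) hmeas ?_
    (fun A hA => (hνfin A (hmeas A hA) hA.2).ne)
    (fun n A hA => (hνnfin n A (hmeas A hA) hA.2).ne) ?_ f
    (fun i => ⟨hf i, fun h => h0 (closure_mono (subset_iUnion f i) h)⟩)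
  · rintro A ⟨⟨a, b, c, d, rfl⟩, hA⟩ B ⟨⟨a', b', c', d', rfl⟩, -⟩
    refine ⟨⟨a ⊔ a', b ⊓ b', c ⊔ c', d ⊓ d', ?_⟩,
      fun h => hA (closure_mono inter_subset_left h)⟩
    rw [prod_inter_prod, Ioo_inter_Ioo, Ioo_inter_Ioo]
  · rintro A ⟨⟨a, b, c, d, rfl⟩, hA⟩
    exact hrect _ _ ⟨a, b, Or.inl rfl⟩ ⟨c, d, Or.inl rfl⟩ hA
end

section
/- For every ε > 0 the quantity σ(ε)² = ∫_{x²+y²≤ε²} (x²+y²) dν(x,y) is finite and strictly positive, and for all ε ∈ (0,1) it holds that σ(ε) = ε^{1 − α/2} σ(1). -/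
open MeasureTheory Filter Set
open scoped ENNReal NNReal Topology

noncomputable def C0 (α : ℝ) : ℝ :=
  (∑' k : ℕ, (((k : ℝ) + 2) - 1) * (((k : ℝ) + 2) - 2) / (2 * ((k : ℝ) + 2) ^ (α + 2)))⁻¹

noncomputable def C1 (α : ℝ) : ℝ :=
  C0 α * (1 + C0 α * ∑' k : ℕ, (((k : ℝ) + 2) - 1) * ((k : ℝ) + 2) ^ (-α - 2))⁻¹

/-- The measure `ν` on `ℝ²` with density `C₁ 1_{x<0} 1_{y>0} (-x+y)^{-α-2}`. -/
noncomputable def nuMeas (α : ℝ) : Measure (ℝ × ℝ) :=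
  (volume : Measure (ℝ × ℝ)).withDensity fun z =>
    if z.1 < 0 ∧ 0 < z.2 then ENNReal.ofReal (C1 α * (-z.1 + z.2) ^ (-α - 2)) else 0

/-- `σ(ε)² = ∫_{x²+y²≤ε²} (x²+y²) dν(x,y)` (as an extended real). -/
noncomputable def sigmaSq (α ε : ℝ) : ℝ≥0∞ :=
  ∫⁻ z in {z : ℝ × ℝ | z.1 ^ 2 + z.2 ^ 2 ≤ ε ^ 2},
    ENNReal.ofReal (z.1 ^ 2 + z.2 ^ 2) ∂(nuMeas α)

/-- `σ(ε)`. -/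
noncomputable def sigmaEps (α ε : ℝ) : ℝ := Real.sqrt (sigmaSq α ε).toReal

theorem C0_pos {α : ℝ} (hα : 1 < α) : 0 < C0 α := by
  unfold C0
  have hnonneg : ∀ k : ℕ, 0 ≤ (((k : ℝ) + 2) - 1) * (((k : ℝ) + 2) - 2) /
      (2 * ((k : ℝ) + 2) ^ (α + 2)) := fun k => by
    have hk : (0 : ℝ) ≤ k := k.cast_nonneg
    have h1 : (0 : ℝ) ≤ (k : ℝ) + 2 - 1 := by linarith
    have h2 : (0 : ℝ) ≤ (k : ℝ) + 2 - 2 := by linarith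
    positivity
  have hsum : Summable fun k : ℕ => (((k : ℝ) + 2) - 1) * (((k : ℝ) + 2) - 2) /
      (2 * ((k : ℝ) + 2) ^ (α + 2)) := by
    have hbase : Summable fun k : ℕ => 1 / ((k + 2 : ℕ) : ℝ) ^ α :=
      (summable_nat_add_iff 2).2 (Real.summable_one_div_nat_rpow.2 hα)
    refine Summable.of_nonneg_of_le hnonneg (fun k => ?_) hbase
    have hk : (0 : ℝ) ≤ k := k.cast_nonneg
    have hk2 : (0 : ℝ) < (k : ℝ) + 2 := by linarith
    have hpos : 0 < ((k : ℝ) + 2) ^ α := Real.rpow_pos_of_pos hk2 α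
    push_cast
    rw [Real.rpow_add hk2, Real.rpow_two, div_le_div_iff₀ (by positivity) hpos]
    nlinarith [mul_nonneg hpos.le hk, mul_nonneg hpos.le (mul_nonneg hk hk)]
  refine inv_pos.2 (hsum.tsum_pos hnonneg 1 ?_)
  have : (0 : ℝ) < (((1 : ℕ) : ℝ) + 2) ^ (α + 2) := by positivity
  norm_num at this ⊢
  exact this

theorem C1_pos {α : ℝ} (hα : 1 < α) : 0 < C1 α := by
  have h0 := C0_pos hα
  have : 0 ≤ ∑' k : ℕ, (((k : ℝ) + 2) - 1) * ((k : ℝ) + 2) ^ (-α - 2) :=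
    tsum_nonneg fun k => by
      have hk : (0 : ℝ) ≤ k := k.cast_nonneg
      have h1 : (0 : ℝ) ≤ (k : ℝ) + 2 - 1 := by linarith
      positivity
  unfold C1
  positivity

/-- The integrand of `sigmaSq` with respect to Lebesgue measure on the disk. -/
noncomputable def sigmaDensity (α : ℝ) (z : ℝ × ℝ) : ℝ≥0∞ :=
  if z.1 < 0 ∧ 0 < z.2 then
    ENNReal.ofReal (C1 α * (-z.1 + z.2) ^ (-α - 2) * (z.1 ^ 2 + z.2 ^ 2)) else 0

theorem measurableSet_quadrant : MeasurableSet {z : ℝ × ℝ | z.1 < 0 ∧ 0 < z.2} :=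
  (measurableSet_lt measurable_fst measurable_const).inter
    (measurableSet_lt measurable_const measurable_snd)

theorem measurable_sigmaDensity (α : ℝ) : Measurable (sigmaDensity α) :=
  Measurable.ite measurableSet_quadrant (by fun_prop) measurable_const

theorem measurableSet_disk (ε : ℝ) :
    MeasurableSet {z : ℝ × ℝ | z.1 ^ 2 + z.2 ^ 2 ≤ ε ^ 2} :=
  measurableSet_le (by fun_prop) measurable_const

theorem sigmaSq_eq_setLIntegral {α : ℝ} (hα : 1 < α) (ε : ℝ) :
    sigmaSq α ε = ∫⁻ z in {z : ℝ × ℝ | z.1 ^ 2 + z.2 ^ 2 ≤ ε ^ 2}, sigmaDensity α z := by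
  unfold sigmaSq nuMeas
  rw [setLIntegral_withDensity_eq_setLIntegral_mul _ _ _ (measurableSet_disk ε)]
  · refine lintegral_congr fun z => ?_
    by_cases hz : z.1 < 0 ∧ 0 < z.2
    · have : 0 ≤ -z.1 + z.2 := by linarith [hz.1, hz.2]
      have hC := C1_pos hα
      simp only [Pi.mul_apply, sigmaDensity, if_pos hz]
      rw [← ENNReal.ofReal_mul (by positivity)]
    · simp [sigmaDensity, hz]
  · exact Measurable.ite measurableSet_quadrant (by fun_prop) measurable_const
  · fun_prop

theorem sigmaDensity_smul {α ε : ℝ} (hε : 0 < ε) (z : ℝ × ℝ) :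
    sigmaDensity α (ε • z) = ENNReal.ofReal (ε ^ (-α)) * sigmaDensity α z := by
  have hiff : ((ε • z).1 < 0 ∧ 0 < (ε • z).2) ↔ (z.1 < 0 ∧ 0 < z.2) := by
    simp [mul_neg_iff, hε, not_lt.2 hε.le]
  by_cases hz : z.1 < 0 ∧ 0 < z.2
  · have hpos : 0 ≤ -z.1 + z.2 := by linarith [hz.1, hz.2]
    rw [sigmaDensity, if_pos (hiff.2 hz), sigmaDensity, if_pos hz,
      ← ENNReal.ofReal_mul (by positivity)]
    congr 1
    have h1 : -(ε • z).1 + (ε • z).2 = ε * (-z.1 + z.2) := by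
      simp only [Prod.smul_fst, Prod.smul_snd, smul_eq_mul]; ring
    have h2 : ε ^ (-α) = ε ^ (-α - 2) * ε ^ 2 := by
      rw [← Real.rpow_two, ← Real.rpow_add hε]; ring_nf
    rw [h1, Real.mul_rpow hε.le hpos, h2]
    simp only [Prod.smul_fst, Prod.smul_snd, smul_eq_mul]
    ring
  · rw [sigmaDensity, if_neg (hiff.not.2 hz), sigmaDensity, if_neg hz, mul_zero]

theorem sigmaSq_scaling {α ε : ℝ} (hα : 1 < α) (hε : 0 < ε) :
    sigmaSq α ε = ENNReal.ofReal (ε ^ (2 - α)) * sigmaSq α 1 := by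
  have hmap := Measure.map_addHaar_smul (volume : Measure (ℝ × ℝ)) (inv_ne_zero hε.ne')
  have hemb : MeasurableEmbedding fun z : ℝ × ℝ => ε⁻¹ • z :=
    measurableEmbedding_const_smul₀ (inv_ne_zero hε.ne')
  have key := hemb.lintegral_map (μ := volume)
    ({z : ℝ × ℝ | z.1 ^ 2 + z.2 ^ 2 ≤ 1 ^ 2}.indicator (sigmaDensity α))
  have hfin : |((ε⁻¹) ^ Module.finrank ℝ (ℝ × ℝ))⁻¹| = ε ^ 2 := by
    simp [Module.finrank_prod, abs_of_pos hε]
  rw [hmap, hfin, lintegral_smul_measure, lintegral_indicator (measurableSet_disk 1),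
    ← sigmaSq_eq_setLIntegral hα, smul_eq_mul] at key
  have hpow : ENNReal.ofReal (ε ^ (2 - α)) = ENNReal.ofReal (ε ^ (-α)) * ENNReal.ofReal (ε ^ 2) := by
    rw [← ENNReal.ofReal_mul (by positivity), ← Real.rpow_two, ← Real.rpow_add hε]
    ring_nf
  rw [hpow, mul_assoc, key, ← lintegral_const_mul' _ _ ENNReal.ofReal_ne_top,
    sigmaSq_eq_setLIntegral hα, ← lintegral_indicator (measurableSet_disk ε)]
  refine lintegral_congr fun z => ?_
  have hmem : (ε⁻¹ • z) ∈ {z : ℝ × ℝ | z.1 ^ 2 + z.2 ^ 2 ≤ 1 ^ 2} ↔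
      z ∈ {z : ℝ × ℝ | z.1 ^ 2 + z.2 ^ 2 ≤ ε ^ 2} := by
    simp only [mem_ofPred_eq, Prod.smul_fst, Prod.smul_snd, smul_eq_mul, mul_pow, ← mul_add]
    rw [inv_pow, inv_mul_le_iff₀ (by positivity)]
    simp
  by_cases hz : z ∈ {z : ℝ × ℝ | z.1 ^ 2 + z.2 ^ 2 ≤ ε ^ 2}
  · rw [indicator_of_mem hz, indicator_of_mem (hmem.2 hz), ← sigmaDensity_smul hε,
      smul_inv_smul₀ hε.ne']
  · rw [indicator_of_notMem hz, indicator_of_notMem (hmem.not.2 hz), mul_zero]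

theorem sigmaSq_pos {α ε : ℝ} (hα : 1 < α) (hε : 0 < ε) : 0 < sigmaSq α ε := by
  rw [sigmaSq_eq_setLIntegral hα, setLIntegral_pos_iff (measurable_sigmaDensity α)]
  have hopen : IsOpen (Ioo (-(ε / 2)) 0 ×ˢ Ioo 0 (ε / 2) : Set (ℝ × ℝ)) :=
    isOpen_Ioo.prod isOpen_Ioo
  refine (hopen.measure_pos volume
    ⟨(-(ε / 4), ε / 4), by simp; constructor <;> constructor <;> linarith⟩).trans_le
    (measure_mono ?_)
  rintro ⟨x, y⟩ ⟨⟨hx1, hx2⟩, hy1, hy2⟩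
  dsimp only at hx1 hx2 hy1 hy2
  refine ⟨?_, ?_⟩
  · rw [Function.mem_support, sigmaDensity, if_pos ⟨hx2, hy1⟩]
    have hC := C1_pos hα
    have : 0 < -x + y := by linarith
    exact (ENNReal.ofReal_pos.2 (by positivity)).ne'
  · simp only [mem_ofPred_eq]
    nlinarith

theorem sigmaSq_one_lt_top {α : ℝ} (hα1 : 1 < α) (hα2 : α < 2) : sigmaSq α 1 < ∞ := by
  have hint : IntegrableOn (fun z : ℝ × ℝ => ‖z‖ ^ (-α)) (Metric.ball 0 2) := by
    rw [integrableOn_fun_norm_addHaar volume (f := fun r : ℝ => r ^ (-α))]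
    have h1 : IntegrableOn (fun r : ℝ => r ^ (1 - α)) (Ioo 0 2) :=
      (intervalIntegral.integrableOn_Ioo_rpow_iff (by norm_num)).2 (by linarith)
    refine h1.congr_fun (fun r hr => ?_) measurableSet_Ioo
    simp only [Module.finrank_prod, Module.finrank_self, smul_eq_mul]
    rw [sub_eq_add_neg, Real.rpow_add hr.1]
    norm_num
  have hC := C1_pos hα1
  rw [sigmaSq_eq_setLIntegral hα1]
  refine lt_of_le_of_lt ?_ (hint.const_mul (2 * C1 α)).lintegral_lt_top
  refine (setLIntegral_mono' (measurableSet_disk 1) fun z hz => ?_).trans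
    (lintegral_mono_set (s := {z : ℝ × ℝ | z.1 ^ 2 + z.2 ^ 2 ≤ 1 ^ 2}) fun z hz => ?_)
  · by_cases hq : z.1 < 0 ∧ 0 < z.2
    · rw [sigmaDensity, if_pos hq]
      refine ENNReal.ofReal_le_ofReal ?_
      obtain ⟨hx, hy⟩ := hq
      have hn : ‖z‖ = max (-z.1) z.2 := by
        rw [Prod.norm_def, Real.norm_of_nonpos hx.le, Real.norm_of_nonneg hy.le]
      have hxn : -z.1 ≤ ‖z‖ := hn ▸ le_max_left _ _
      have hyn : z.2 ≤ ‖z‖ := hn ▸ le_max_right _ _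
      have hpos : 0 < ‖z‖ := hy.trans_le hyn
      have hle : ‖z‖ ≤ -z.1 + z.2 := by
        rw [hn]; exact max_le (by linarith) (by linarith)
      have h1 : (-z.1 + z.2) ^ (-α - 2) ≤ ‖z‖ ^ (-α - 2) :=
        Real.rpow_le_rpow_of_nonpos hpos hle (by linarith)
      have h2 : z.1 ^ 2 + z.2 ^ 2 ≤ 2 * ‖z‖ ^ 2 := by nlinarith
      have h3 : ‖z‖ ^ (-α) = ‖z‖ ^ (-α - 2) * ‖z‖ ^ 2 := by
        rw [← Real.rpow_two, ← Real.rpow_add hpos]; ring_nf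
      calc C1 α * (-z.1 + z.2) ^ (-α - 2) * (z.1 ^ 2 + z.2 ^ 2)
          ≤ C1 α * ‖z‖ ^ (-α - 2) * (2 * ‖z‖ ^ 2) := by gcongr
        _ = 2 * C1 α * ‖z‖ ^ (-α) := by rw [h3]; ring
    · rw [sigmaDensity, if_neg hq]
      exact zero_le
  · simp only [mem_ofPred_eq] at hz
    rw [mem_ball_zero_iff, Prod.norm_def, max_lt_iff, Real.norm_eq_abs, Real.norm_eq_abs]
    constructor <;> refine abs_lt_of_sq_lt_sq ?_ (by norm_num) <;>
      nlinarith [sq_nonneg z.1, sq_nonneg z.2]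

/-- For every `ε > 0` the quantity `σ(ε)²` is finite and strictly positive,
and for all `ε ∈ (0,1)` one has `σ(ε) = ε^{1-α/2} σ(1)`. -/
theorem stmt9 (α : ℝ) (hα1 : 1 < α) (hα2 : α < 2) :
    (∀ ε : ℝ, 0 < ε → 0 < sigmaSq α ε ∧ sigmaSq α ε < ∞) ∧
    (∀ ε : ℝ, 0 < ε → ε < 1 → sigmaEps α ε = ε ^ (1 - α / 2) * sigmaEps α 1) := by
  refine ⟨fun ε hε => ⟨sigmaSq_pos hα1 hε, ?_⟩, fun ε hε _ => ?_⟩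
  · rw [sigmaSq_scaling hα1 hε]
    exact ENNReal.mul_lt_top ENNReal.ofReal_lt_top (sigmaSq_one_lt_top hα1 hα2)
  · have hsq : ε ^ (2 - α) = (ε ^ (1 - α / 2)) ^ 2 := by
      rw [← Real.rpow_natCast, ← Real.rpow_mul hε.le]
      congr 1
      push_cast
      ring
    rw [sigmaEps, sigmaEps, sigmaSq_scaling hα1 hε, ENNReal.toReal_mul,
      ENNReal.toReal_ofReal (by positivity), hsq, Real.sqrt_mul (by positivity),
      Real.sqrt_sq (by positivity)]
end

section
/- For every Borel subset B of ℝ² such that 0 does not belong to the closure of B, it holds that ν_ε(B) → 0 as ε → 0; in particular ε/σ(ε) → 0 as ε → 0. -/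
open MeasureTheory Filter Set
open scoped ENNReal NNReal Topology

/-- The measure `ν_ε` on `ℝ²` with density
`C₁ 1_{x<0} 1_{y>0} 1_{x²+y² ≤ ε²/σ(ε)²} σ(ε)^{-α} (-x+y)^{-α-2}`. -/
noncomputable def nuEps (α ε : ℝ) : Measure (ℝ × ℝ) :=
  (volume : Measure (ℝ × ℝ)).withDensity fun z =>
    if z.1 < 0 ∧ 0 < z.2 ∧ z.1 ^ 2 + z.2 ^ 2 ≤ ε ^ 2 / sigmaEps α ε ^ 2 then
      ENNReal.ofReal (C1 α * sigmaEps α ε ^ (-α) * (-z.1 + z.2) ^ (-α - 2))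
    else 0

theorem measurable_nuMeas_density (α : ℝ) : Measurable fun z : ℝ × ℝ =>
    if z.1 < 0 ∧ 0 < z.2 then ENNReal.ofReal (C1 α * (-z.1 + z.2) ^ (-α - 2)) else 0 := by
  refine Measurable.ite ?_ (by fun_prop) measurable_const
  exact (measurableSet_lt measurable_fst measurable_const).inter
    (measurableSet_lt measurable_const measurable_snd)

theorem measurableSet_sq_add_sq_le (r : ℝ) :
    MeasurableSet {z : ℝ × ℝ | z.1 ^ 2 + z.2 ^ 2 ≤ r} :=
  measurableSet_le (by fun_prop) measurable_const

theorem sigmaSq_eq (α ε : ℝ) : sigmaSq α ε =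
    ∫⁻ z in {z : ℝ × ℝ | z.1 ^ 2 + z.2 ^ 2 ≤ ε ^ 2},
      (if z.1 < 0 ∧ 0 < z.2 then ENNReal.ofReal (C1 α * (-z.1 + z.2) ^ (-α - 2)) else 0) *
        ENNReal.ofReal (z.1 ^ 2 + z.2 ^ 2) := by
  unfold sigmaSq nuMeas
  rw [setLIntegral_withDensity_eq_setLIntegral_mul _ (measurable_nuMeas_density α)
    (by fun_prop) (measurableSet_sq_add_sq_le _)]
  rfl

theorem rpow_mul_sq_add_sq_le {α x y : ℝ} (hα : 0 < α) (hx : 0 < x) (hy : 0 < y) :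
    (x + y) ^ (-α - 2) * (x ^ 2 + y ^ 2) ≤ x ^ (-(α / 2)) * y ^ (-(α / 2)) := by
  have hxy : 0 < x + y := by positivity
  calc (x + y) ^ (-α - 2) * (x ^ 2 + y ^ 2) ≤ (x + y) ^ (-α - 2) * (x + y) ^ 2 := by
        gcongr
        nlinarith [mul_pos hx hy]
    _ = ((x + y) ^ 2) ^ (-(α / 2)) := by
        rw [← Real.rpow_two, ← Real.rpow_add hxy, ← Real.rpow_mul hxy.le]
        congr 1
        ring
    _ ≤ (x * y) ^ (-(α / 2)) := by
        refine Real.rpow_le_rpow_of_nonpos (by positivity) ?_ (by linarith)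
        nlinarith [mul_pos hx hy, sq_nonneg x, sq_nonneg y]
    _ = x ^ (-(α / 2)) * y ^ (-(α / 2)) := Real.mul_rpow hx.le hy.le

theorem sigmaSq_ne_top {α ε : ℝ} (hα1 : 1 < α) (hα2 : α < 2) (hε : 0 < ε) :
    sigmaSq α ε ≠ ∞ := by
  have hC := C1_pos hα1
  set G : ℝ → ℝ≥0∞ := (Ioc 0 ε).indicator fun t => ENNReal.ofReal (t ^ (-(α / 2))) with hG
  have hGm : Measurable G := Measurable.indicator (by fun_prop) measurableSet_Ioc
  have hGfin : ∫⁻ t, G t ≠ ∞ := by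
    rw [hG, lintegral_indicator measurableSet_Ioc]
    have h := intervalIntegral.intervalIntegrable_rpow' (a := 0) (b := ε)
      (by linarith : -1 < -(α / 2))
    exact ((intervalIntegrable_iff_integrableOn_Ioc_of_le hε.le).1 h).lintegral_lt_top.ne
  have hGneg : ∫⁻ t, G (-t) = ∫⁻ t, G t := lintegral_neg_eq_self G
  have hprod : ∫⁻ z : ℝ × ℝ, ENNReal.ofReal (C1 α) * (G (-z.1) * G z.2) ≠ ∞ := by
    rw [lintegral_const_mul _ (by fun_prop), Measure.volume_eq_prod,
      lintegral_prod_mul (f := fun t => G (-t)) (by fun_prop) hGm.aemeasurable, hGneg]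
    exact ENNReal.mul_ne_top ENNReal.ofReal_ne_top (ENNReal.mul_ne_top hGfin hGfin)
  rw [sigmaSq_eq, ← lintegral_indicator (measurableSet_sq_add_sq_le _)]
  refine ne_top_of_le_ne_top hprod (lintegral_mono fun z => ?_)
  refine indicator_apply_le' (fun hz => ?_) fun _ => zero_le
  split_ifs with h
  · obtain ⟨hx, hy⟩ := h
    have hz' : z.1 ^ 2 + z.2 ^ 2 ≤ ε ^ 2 := hz
    have hx' : -z.1 ∈ Ioc 0 ε := ⟨by linarith, by nlinarith [sq_nonneg z.2]⟩
    have hy' : z.2 ∈ Ioc 0 ε := ⟨hy, by nlinarith [sq_nonneg z.1]⟩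
    rw [hG, indicator_of_mem hx', indicator_of_mem hy', ← ENNReal.ofReal_mul' (by positivity),
      ← ENNReal.ofReal_mul' (by have := hx'.1; positivity), ← ENNReal.ofReal_mul hC.le, mul_assoc]
    have := rpow_mul_sq_add_sq_le (α := α) (by linarith) hx'.1 hy
    rw [neg_sq] at this
    gcongr
  · simp

theorem le_sigmaSq {α ε : ℝ} (hα1 : 1 < α) (hε : 0 < ε) :
    ENNReal.ofReal (C1 α / 128 * ε ^ (2 - α)) ≤ sigmaSq α ε := by
  have hC := C1_pos hα1
  set R : Set (ℝ × ℝ) := Icc (-(ε / 2)) (-(ε / 4)) ×ˢ Icc (ε / 4) (ε / 2) with hR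
  have hRS : R ⊆ {z : ℝ × ℝ | z.1 ^ 2 + z.2 ^ 2 ≤ ε ^ 2} := by
    rintro ⟨x, y⟩ ⟨⟨h1, h2⟩, h3, h4⟩
    simp only [mem_ofPred_eq] at *
    nlinarith
  have hvol : volume R = ENNReal.ofReal (ε / 4 * (ε / 4)) := by
    rw [hR, Measure.volume_eq_prod, Measure.prod_prod, Real.volume_Icc, Real.volume_Icc,
      ← ENNReal.ofReal_mul (by linarith)]
    congr 1
    ring
  have hpow : C1 α / 128 * ε ^ (2 - α) =
      C1 α * ε ^ (-α - 2) * (ε ^ 2 / 8) * (ε / 4 * (ε / 4)) := by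
    have : ε ^ (2 - α) = ε ^ (-α - 2) * ε ^ 4 := by
      rw [← Real.rpow_natCast, ← Real.rpow_add hε]
      congr 1
      push_cast
      ring
    rw [this]
    ring
  rw [sigmaSq_eq, hpow, ENNReal.ofReal_mul (by positivity), ← hvol, ← setLIntegral_const]
  refine (setLIntegral_mono' (measurableSet_Icc.prod measurableSet_Icc) ?_).trans
    (lintegral_mono_set hRS)
  rintro ⟨x, y⟩ ⟨⟨h1, h2⟩, h3, h4⟩
  simp only at *
  have hx : x < 0 := by linarith
  have hy : 0 < y := by linarith
  rw [if_pos ⟨hx, hy⟩, ← ENNReal.ofReal_mul' (by positivity)]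
  refine ENNReal.ofReal_le_ofReal ?_
  have hxy : 0 < -x + y := by linarith
  have hmono : ε ^ (-α - 2) ≤ (-x + y) ^ (-α - 2) :=
    Real.rpow_le_rpow_of_nonpos hxy (by linarith) (by linarith)
  have hsq : ε ^ 2 / 8 ≤ x ^ 2 + y ^ 2 := by nlinarith
  gcongr

theorem le_sigmaEps_sq {α ε : ℝ} (hα1 : 1 < α) (hα2 : α < 2) (hε : 0 < ε) :
    C1 α / 128 * ε ^ (2 - α) ≤ sigmaEps α ε ^ 2 := by
  unfold sigmaEps
  rw [Real.sq_sqrt ENNReal.toReal_nonneg]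
  exact (ENNReal.ofReal_le_iff_le_toReal (sigmaSq_ne_top hα1 hα2 hε)).1 (le_sigmaSq hα1 hε)

theorem sq_div_sigmaEps_sq_le {α ε : ℝ} (hα1 : 1 < α) (hα2 : α < 2) (hε : 0 < ε) :
    ε ^ 2 / sigmaEps α ε ^ 2 ≤ 128 / C1 α * ε ^ α := by
  have hC := C1_pos hα1
  have h := le_sigmaEps_sq hα1 hα2 hε
  have hpos : 0 < C1 α / 128 * ε ^ (2 - α) := by positivity
  rw [div_le_iff₀ (hpos.trans_le h)]
  calc ε ^ 2 = 128 / C1 α * ε ^ α * (C1 α / 128 * ε ^ (2 - α)) := by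
        have : ε ^ 2 = ε ^ α * ε ^ (2 - α) := by
          rw [← Real.rpow_add hε, ← Real.rpow_two]
          congr 1
          ring
        rw [this]
        field_simp
    _ ≤ _ := by gcongr

theorem tendsto_sq_div_sigmaEps_sq {α : ℝ} (hα1 : 1 < α) (hα2 : α < 2) :
    Tendsto (fun ε : ℝ => ε ^ 2 / sigmaEps α ε ^ 2) (𝓝[>] 0) (𝓝 0) := by
  have h : Tendsto (fun ε : ℝ => 128 / C1 α * ε ^ α) (𝓝[>] 0) (𝓝 0) := by
    have hc : ContinuousAt (fun ε : ℝ => 128 / C1 α * ε ^ α) 0 :=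
      continuousAt_const.mul (Real.continuousAt_rpow_const _ _ (Or.inr (by linarith)))
    have := hc.tendsto
    rw [Real.zero_rpow (by linarith), mul_zero] at this
    exact this.mono_left nhdsWithin_le_nhds
  refine squeeze_zero' (Eventually.of_forall fun ε => by positivity) ?_ h
  filter_upwards [self_mem_nhdsWithin] with ε hε
  exact sq_div_sigmaEps_sq_le hα1 hα2 hε

theorem nuEps_eq_zero {α ε δ : ℝ} {B : Set (ℝ × ℝ)} (hB : MeasurableSet B) (hδ : 0 < δ)
    (hBδ : ∀ z ∈ B, δ ≤ dist 0 z) (h : ε ^ 2 / sigmaEps α ε ^ 2 < δ ^ 2) :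
    nuEps α ε B = 0 := by
  unfold nuEps
  rw [withDensity_apply _ hB]
  refine setLIntegral_eq_zero hB fun z hz => if_neg ?_
  rintro ⟨-, -, hle⟩
  have hd := hBδ z hz
  rw [Prod.dist_eq, le_max_iff] at hd
  simp only [Prod.fst_zero, Prod.snd_zero, dist_zero_left, Real.norm_eq_abs] at hd
  rcases hd with hd | hd
  · nlinarith [sq_le_sq' (by linarith) hd, sq_abs z.1, sq_nonneg z.2]
  · nlinarith [sq_le_sq' (by linarith) hd, sq_abs z.2, sq_nonneg z.1]

/-- For every Borel `B ⊆ ℝ²` with `0 ∉ closure B` one has `ν_ε(B) → 0`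
as `ε → 0⁺`; in particular `ε / σ(ε) → 0` as `ε → 0⁺`. -/
theorem stmt12 (α : ℝ) (hα1 : 1 < α) (hα2 : α < 2) :
    (∀ B : Set (ℝ × ℝ), MeasurableSet B → (0 : ℝ × ℝ) ∉ closure B →
      Filter.Tendsto (fun ε : ℝ => nuEps α ε B) (𝓝[>] (0 : ℝ)) (𝓝 (0 : ℝ≥0∞))) ∧
    Filter.Tendsto (fun ε : ℝ => ε / sigmaEps α ε) (𝓝[>] (0 : ℝ)) (𝓝 (0 : ℝ)) := by
  have hlim := tendsto_sq_div_sigmaEps_sq hα1 hα2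
  refine ⟨fun B hB h0 => ?_, ?_⟩
  · obtain ⟨δ, hδ, hBδ⟩ : ∃ δ > 0, ∀ z ∈ B, δ ≤ dist 0 z := by
      simpa only [Metric.mem_closure_iff, not_forall, not_exists, not_and, not_lt,
        exists_prop] using h0
    refine tendsto_const_nhds.congr' ?_
    filter_upwards [hlim.eventually_lt_const (by positivity : 0 < δ ^ 2)] with ε hε
    exact (nuEps_eq_zero hB hδ hBδ hε).symm
  · have h := hlim.sqrt
    rw [Real.sqrt_zero] at h
    refine squeeze_zero_norm (fun ε => ?_) h
    rw [← div_pow, Real.sqrt_sq_eq_abs, Real.norm_eq_abs]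
end

section
/- Let Π be the measure on ℝ with density C₁ x^{−α−1} 1_{x>0} dx, let m be Lebesgue measure restricted to [0,1], and let F : (0,∞) × [0,1] → ℝ² be given by F(x,u) = (−ux, (1−u)x). Then the pushforward of the product measure Π ⊗ m under F equals ν. -/
open MeasureTheory Filter Set
open scoped ENNReal NNReal Topology

/-- The measure `Π` on `ℝ` with density `C₁ x^{-α-1} 1_{x>0}`. -/
noncomputable def PiMeas (α : ℝ) : Measure ℝ :=
  (volume : Measure ℝ).withDensity fun x =>
    if 0 < x then ENNReal.ofReal (C1 α * x ^ (-α - 1)) else 0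

/-- The derivative of `(x, u) ↦ (-ux, (1-u)x)`, as a continuous linear map. -/
noncomputable def fderivSplit (p : ℝ × ℝ) : ℝ × ℝ →L[ℝ] ℝ × ℝ :=
  (Matrix.toLin (.finTwoProd ℝ) (.finTwoProd ℝ)
    !![-p.2, -p.1; 1 - p.2, -p.1]).toContinuousLinearMap

theorem hasFDerivAt_split (p : ℝ × ℝ) :
    HasFDerivAt (fun p : ℝ × ℝ => (-p.2 * p.1, (1 - p.2) * p.1)) (fderivSplit p) p := by
  unfold fderivSplit
  rw [Matrix.toLin_finTwoProd_toContinuousLinearMap]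
  have h1 : HasFDerivAt (fun p : ℝ × ℝ => p.1) (ContinuousLinearMap.fst ℝ ℝ ℝ) p := hasFDerivAt_fst
  have h2 : HasFDerivAt (fun p : ℝ × ℝ => p.2) (ContinuousLinearMap.snd ℝ ℝ ℝ) p := hasFDerivAt_snd
  refine ((h2.neg.mul h1).prodMk ((h2.const_sub 1).mul h1)).congr_fderiv ?_
  ext <;> simp

theorem det_fderivSplit (p : ℝ × ℝ) : (fderivSplit p).det = p.1 := by
  simp only [fderivSplit, LinearMap.det_toContinuousLinearMap, LinearMap.det_toLin,
    Matrix.det_fin_two_of]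
  ring

theorem injOn_split :
    InjOn (fun p : ℝ × ℝ => (-p.2 * p.1, (1 - p.2) * p.1)) (Ioi 0 ×ˢ Ioo 0 1) := by
  rintro ⟨x, u⟩ ⟨hx, -⟩ ⟨y, v⟩ - h
  simp only [Prod.mk.injEq, mem_Ioi] at h hx ⊢
  have hxy : x = y := by linarith [h.1, h.2]
  subst hxy
  exact ⟨rfl, mul_right_cancel₀ hx.ne' (by linarith [h.1])⟩

theorem image_split :
    (fun p : ℝ × ℝ => (-p.2 * p.1, (1 - p.2) * p.1)) '' (Ioi 0 ×ˢ Ioo 0 1) =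
      Iio 0 ×ˢ Ioi 0 := by
  ext ⟨a, b⟩
  simp only [mem_image, mem_prod, mem_Ioi, mem_Iio, mem_Ioo, Prod.exists, Prod.mk.injEq]
  constructor
  · rintro ⟨x, u, ⟨hx, hu0, hu1⟩, rfl, rfl⟩
    exact ⟨by nlinarith, mul_pos (by linarith) hx⟩
  · rintro ⟨ha, hb⟩
    have hab : 0 < b - a := by linarith
    refine ⟨b - a, -a / (b - a), ⟨hab, div_pos (by linarith) hab, ?_⟩, ?_, ?_⟩
    · rw [div_lt_one hab]
      linarith
    · field_simp
    · field_simp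
      ring

theorem PiMeas_eq_restrict_withDensity (α : ℝ) :
    PiMeas α = (volume.restrict (Ioi 0)).withDensity
      fun x => ENNReal.ofReal (C1 α * x ^ (-α - 1)) := by
  rw [← withDensity_indicator measurableSet_Ioi]
  rfl

theorem nuMeas_eq_restrict_withDensity (α : ℝ) :
    nuMeas α = (volume.restrict (Iio 0 ×ˢ Ioi 0)).withDensity
      fun z => ENNReal.ofReal (C1 α * (-z.1 + z.2) ^ (-α - 2)) := by
  rw [← withDensity_indicator (measurableSet_Iio.prod measurableSet_Ioi)]
  unfold nuMeas
  congr 1 with z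
  simp only [indicator_apply, mem_prod, mem_Iio, mem_Ioi]

theorem PiMeas_prod_restrict (α : ℝ) :
    (PiMeas α).prod ((volume : Measure ℝ).restrict (Icc 0 1)) =
      (volume.restrict (Ioi 0 ×ˢ Ioo 0 1)).withDensity
        fun p : ℝ × ℝ => ENNReal.ofReal (C1 α * p.1 ^ (-α - 1)) := by
  rw [PiMeas_eq_restrict_withDensity, ← Measure.restrict_congr_set (Ioo_ae_eq_Icc (μ := volume)),
    prod_withDensity_left (by fun_prop), Measure.prod_restrict, Measure.volume_eq_prod]

/-- With `Π` the measure with density `C₁ x^{-α-1} 1_{x>0}`, `m` Lebesgue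
measure restricted to `[0,1]`, and `F(x,u) = (-ux, (1-u)x)`, the pushforward of `Π ⊗ m`
under `F` equals `ν`. -/
theorem stmt18 (α : ℝ) (hα1 : 1 < α) (hα2 : α < 2) :
    Measure.map (fun p : ℝ × ℝ => (-p.2 * p.1, (1 - p.2) * p.1))
        ((PiMeas α).prod ((volume : Measure ℝ).restrict (Set.Icc 0 1))) = nuMeas α := by
  refine Measure.ext_of_lintegral _ fun φ hφ => ?_
  have hU : MeasurableSet ((Ioi 0 : Set ℝ) ×ˢ (Ioo 0 1 : Set ℝ)) :=
    measurableSet_Ioi.prod measurableSet_Ioo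
  rw [lintegral_map hφ (by fun_prop), PiMeas_prod_restrict, nuMeas_eq_restrict_withDensity,
    lintegral_withDensity_eq_lintegral_mul _ (by fun_prop) (by fun_prop),
    lintegral_withDensity_eq_lintegral_mul _ (by fun_prop) hφ, ← image_split,
    lintegral_image_eq_lintegral_abs_det_fderiv_mul volume hU
      (fun p _ => (hasFDerivAt_split p).hasFDerivWithinAt) injOn_split]
  refine setLIntegral_congr_fun hU fun p hp => ?_
  have hx : 0 < p.1 := hp.1
  have hsum : -(-p.2 * p.1) + (1 - p.2) * p.1 = p.1 := by ring
  have hpow : p.1 ^ (-α - 1) = p.1 * p.1 ^ (-α - 2) := by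
    rw [← Real.rpow_one_add' hx.le (by linarith)]
    ring_nf
  simp only [Pi.mul_apply, det_fderivSplit, abs_of_pos hx, hsum, hpow]
  rw [mul_left_comm (C1 α), ENNReal.ofReal_mul hx.le, mul_assoc]
end
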